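/- Asymptotic behaviour of the denumerant: Let a_1, a_2, … be positive integers and let k ≥ 2 satisfy gcd(a_1,…,a_k) = 1. Then the real-valued function n ↦ D^a_k(n) − n^{k−1}/((k−1)! · a_1 a_2 ⋯ a_k) is O(n^{k−2}) as n → +∞ (big-O along the atTop filter on ℕ). -/

import Mathlib

/-- The denumerant: number of tuples `(x 1, …, x k)` of naturals with
`a 1 * x 1 + ⋯ + a k * x k = n`. -/
noncomputable def D (a : ℕ → ℕ) (k n : ℕ) : ℕ :=
  {x : Fin k → ℕ | ∑ i, a (i.1 + 1) * x i = n}.ncard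

/-- The cumulative denumerant: number of tuples with
`a 1 * x 1 + ⋯ + a k * x k ≤ n`. -/
noncomputable def Dhat (a : ℕ → ℕ) (k n : ℕ) : ℕ :=
  {x : Fin k → ℕ | ∑ i, a (i.1 + 1) * x i ≤ n}.ncard

/-- `gcdUpTo a i = gcd (a 1, …, a i)`. -/
def gcdUpTo (a : ℕ → ℕ) (i : ℕ) : ℕ := (Finset.Icc 1 i).gcd a

/-- The sequence `s⁺` of rationals. -/
def sPlus (a : ℕ → ℕ) : ℕ → ℚ
  | 0 => 0
  | 1 => (a 1 * a 2 : ℚ) / (2 * gcdUpTo a 2)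
  | i + 2 => sPlus a (i + 1) + ((gcdUpTo a (i + 1) : ℚ) / (2 * gcdUpTo a (i + 2))) * a (i + 2)

/-- The sequence `s⁻` of integers. -/
def sMinus (a : ℕ → ℕ) : ℕ → ℤ
  | 0 => 0
  | 1 => -(a 1 : ℤ)
  | i + 2 => sMinus a (i + 1) +
      (((gcdUpTo a (i + 1) / gcdUpTo a (i + 2) : ℕ) : ℤ) - 1) * (a (i + 2) : ℤ)

/-- Auxiliary recursion for the Blom–Fröberg number, with `m : ℕ`. -/
def bfAux (a : ℕ → ℕ) (r : ℕ) : ℕ → ℤ → ℚ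
  | 0, l => if l = 0 then 1 else 0
  | m + 1, l =>
      if l < 0 ∨ (m + 1 : ℤ) < l then 0
      else bfAux a r m l + (a (m + 1 + r) : ℚ) / 2 * bfAux a r m (l - 1)

/-- The Blom–Fröberg number `[m ℓ]^a_r`. -/
def bf (a : ℕ → ℕ) (r : ℕ) (m l : ℤ) : ℚ :=
  if m < 0 then 0 else bfAux a r m.toNat l


theorem finite_setOf_sum_mul_eq {ι : Type*} [Fintype ι] (w : ι → ℕ) (hw : ∀ i, 1 ≤ w i) (n : ℕ) :
    {x : ι → ℕ | ∑ i, w i * x i = n}.Finite := by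
  classical
  refine (Set.finite_Iic (fun _ : ι => n)).subset fun x hx i => ?_
  have h1 : w i * x i ≤ ∑ i, w i * x i :=
    Finset.single_le_sum (f := fun i => w i * x i) (fun _ _ => Nat.zero_le _) (Finset.mem_univ i)
  have h2 : ∑ i, w i * x i = n := hx
  exact (Nat.le_mul_of_pos_left (x i) (hw i)).trans (h1.trans h2.le)

theorem D_one (a : ℕ → ℕ) (ha : ∀ i, 1 ≤ a i) (n : ℕ) : D a 1 n = if a 1 ∣ n then 1 else 0 := by
  unfold D
  split_ifs with h
  · obtain ⟨q, rfl⟩ := h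
    rw [Set.ncard_eq_one]
    refine ⟨fun _ => q, ?_⟩
    ext x
    have : a 1 ≠ 0 := by have := ha 1; omega
    simp [funext_iff, this]
  · rw [Set.ncard_eq_zero (finite_setOf_sum_mul_eq _ (fun i => ha _) n)]
    ext x
    simp only [Set.mem_ofPred_eq, Set.mem_empty_iff_false, iff_false]
    rintro rfl
    simp at h

theorem D_succ_add (a : ℕ → ℕ) (ha : ∀ i, 1 ≤ a i) (k n : ℕ) :
    D a (k + 1) (n + a (k + 1)) = D a (k + 1) n + D a k (n + a (k + 1)) := by
  unfold D
  have hinj₁ : Function.Injective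
      fun x : Fin (k + 1) → ℕ => x + Pi.single (Fin.last k) 1 := add_left_injective _
  have hinj₂ : Function.Injective
      fun x : Fin k → ℕ => (Fin.snoc x 0 : Fin (k + 1) → ℕ) := fun x y h => by
    simpa using congrArg Fin.init h
  rw [← Set.ncard_image_of_injective {x : Fin (k + 1) → ℕ | ∑ i, a (i.1 + 1) * x i = n} hinj₁,
    ← Set.ncard_image_of_injective {x : Fin k → ℕ | _} hinj₂, ← Set.ncard_union_eq ?_
      ((finite_setOf_sum_mul_eq _ (fun i => ha _) _).image _)
      ((finite_setOf_sum_mul_eq _ (fun i => ha _) _).image _)]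
  · congr 1
    ext x
    simp only [Set.mem_ofPred_eq, Set.mem_union, Set.mem_image]
    constructor
    · intro h
      rw [Fin.sum_univ_castSucc] at h
      rcases Nat.eq_zero_or_pos (x (Fin.last k)) with h0 | h0
      · refine Or.inr ⟨Fin.init x, by simpa [h0, Fin.init] using h, ?_⟩
        rw [← h0, Fin.snoc_init_self]
      · refine Or.inl ⟨x - Pi.single (Fin.last k) 1, ?_, ?_⟩
        · rw [Fin.sum_univ_castSucc]
          obtain ⟨y, hy⟩ : ∃ y, x (Fin.last k) = y + 1 := ⟨_, (Nat.succ_pred_eq_of_pos h0).symm⟩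
          simp [hy, mul_add] at h ⊢
          omega
        · refine tsub_add_cancel_of_le fun i => ?_
          rcases eq_or_ne i (Fin.last k) with rfl | hi
          · simpa using Nat.succ_le_of_lt h0
          · simp [hi]
    · rintro (⟨y, h, rfl⟩ | ⟨y, h, rfl⟩)
      · rw [← h, Fin.sum_univ_castSucc, Fin.sum_univ_castSucc]
        simp [mul_add, add_assoc]
      · rw [← h, Fin.sum_univ_castSucc]
        simp
  · rw [Set.disjoint_left]
    rintro _ ⟨y, -, rfl⟩ ⟨z, -, h⟩
    simpa using congrFun h (Fin.last k)

theorem card_filter_dvd_add_mul (g a n : ℕ) (hg : 0 < g) :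
    ((Finset.range (g / g.gcd a)).filter fun j => g ∣ n + a * (j + 1)).card =
      if g.gcd a ∣ n then 1 else 0 := by
  have hd : 0 < g.gcd a := Nat.gcd_pos_of_pos_left _ hg
  obtain ⟨h, b, hcop, hg', ha'⟩ := Nat.exists_coprime g a
  set d := g.gcd a
  have hh : h ≠ 0 := by rintro rfl; omega
  have hdiv : g / d = h := by rw [hg']; exact Nat.mul_div_cancel _ hd
  rw [hdiv]
  split_ifs with hn
  · obtain ⟨q, rfl⟩ := hn
    have key : ∀ j, g ∣ d * q + a * (j + 1) ↔ h ∣ q + b * (j + 1) := fun j => by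
      rw [hg', ha', show d * q + b * d * (j + 1) = (q + b * (j + 1)) * d by ring]
      exact Nat.mul_dvd_mul_iff_right hd
    obtain ⟨j, hj, hmod⟩ := Nat.exists_mul_mod_eq_of_coprime ((h - 1) * (q + b)) hcop.symm hh
    have hdvd : h ∣ q + b * (j + 1) := by
      have h1 : b * j ≡ (h - 1) * (q + b) [MOD h] := hmod
      have h2 := h1.add_left (q + b)
      obtain ⟨p, rfl⟩ := Nat.exists_eq_succ_of_ne_zero hh
      refine (h2.dvd_iff dvd_rfl).2 ⟨q + b, ?_⟩ |>.trans (dvd_of_eq (by ring))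
      simp
      ring
    refine Finset.card_eq_one.2 ⟨j, Finset.ext fun i => ?_⟩
    simp only [Finset.mem_filter, Finset.mem_range, Finset.mem_singleton, key]
    refine ⟨fun ⟨hi, hi'⟩ => ?_, fun hi => hi ▸ ⟨hj, hdvd⟩⟩
    have h1 : q + b * (i + 1) ≡ q + b * (j + 1) [MOD h] :=
      ((Nat.modEq_zero_iff_dvd).2 hi').trans ((Nat.modEq_zero_iff_dvd).2 hdvd).symm
    have h2 := (Nat.ModEq.add_left_cancel' q h1).cancel_left_of_coprime hcop
    exact (Nat.ModEq.add_right_cancel' 1 h2).eq_of_lt_of_lt hi hj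
  · refine Finset.card_eq_zero.2 (Finset.filter_eq_empty_iff.2 fun j _ hj => hn ?_)
    exact (Nat.dvd_add_left ((Nat.gcd_dvd_right g a).mul_right _)).1
      ((Nat.gcd_dvd_left g a).trans hj)

theorem abs_add_pow_sub_pow_le (t : ℝ) (ht : 0 ≤ t) (m n : ℕ) :
    |((n : ℝ) + t) ^ m - (n : ℝ) ^ m| ≤ t * (1 + t) ^ (m - 1) * m * ((n : ℝ) + 1) ^ (m - 1) := by
  have hn : (0 : ℝ) ≤ n := n.cast_nonneg
  have h := abs_pow_sub_pow_le ((n : ℝ) + t) n m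
  rw [add_sub_cancel_left, abs_of_nonneg ht, abs_of_nonneg hn,
    abs_of_nonneg (by positivity : 0 ≤ (n : ℝ) + t), max_eq_left (by linarith)] at h
  refine h.trans ?_
  have h1 : ((n : ℝ) + t) ^ (m - 1) ≤ ((1 + t) * (n + 1)) ^ (m - 1) :=
    pow_le_pow_left₀ (by positivity) (by nlinarith) _
  rw [mul_pow] at h1
  calc t * m * ((n : ℝ) + t) ^ (m - 1)
      ≤ t * m * ((1 + t) ^ (m - 1) * (n + 1) ^ (m - 1)) := by gcongr
    _ = _ := by ring

theorem exists_abs_add_pow_succ_sub_le (t : ℝ) (ht : 0 ≤ t) (m : ℕ) :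
    ∃ K : ℝ, 0 ≤ K ∧ ∀ n : ℕ, |((n : ℝ) + t) ^ (m + 1) - (n : ℝ) ^ (m + 1) - (m + 1) * t * n ^ m| ≤
      K * m * ((n : ℝ) + 1) ^ (m - 1) := by
  induction m with
  | zero => exact ⟨0, le_rfl, fun n => by simp⟩
  | succ m ih =>
    obtain ⟨K, hK, h⟩ := ih
    refine ⟨K + t * (t * (1 + t) ^ m), by positivity, fun n => ?_⟩
    have hn : (0 : ℝ) ≤ n := n.cast_nonneg
    have h1 : |(n : ℝ) * (((n : ℝ) + t) ^ (m + 1) - (n : ℝ) ^ (m + 1) - (m + 1) * t * n ^ m)| ≤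
        K * m * ((n : ℝ) + 1) ^ m := by
      rw [abs_mul, abs_of_nonneg hn]
      rcases m with _ | m
      · simp
      · calc _ ≤ ((n : ℝ) + 1) * (K * (m + 1 : ℕ) * ((n : ℝ) + 1) ^ m) :=
              mul_le_mul (by linarith) (h n) (abs_nonneg _) (by positivity)
          _ = _ := by ring
    have h2 := abs_add_pow_sub_pow_le t ht (m + 1) n
    have h3 : |t * (((n : ℝ) + t) ^ (m + 1) - (n : ℝ) ^ (m + 1))| ≤
        t * (t * (1 + t) ^ m * (m + 1 : ℕ) * ((n : ℝ) + 1) ^ m) := by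
      rw [abs_mul, abs_of_nonneg ht]
      exact mul_le_mul_of_nonneg_left h2 ht
    have h4 : K * m * ((n : ℝ) + 1) ^ m ≤ K * (m + 1 : ℕ) * ((n : ℝ) + 1) ^ m := by
      gcongr; omega
    calc _ = |(n : ℝ) * (((n : ℝ) + t) ^ (m + 1) - (n : ℝ) ^ (m + 1) - (m + 1) * t * n ^ m) +
            t * (((n : ℝ) + t) ^ (m + 1) - (n : ℝ) ^ (m + 1))| := by
          congr 1; push_cast; ring
      _ ≤ _ := (abs_add_le _ _).trans (add_le_add h1 h3)
      _ ≤ _ := by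
          simp only [Nat.add_sub_cancel]
          linarith

theorem exists_abs_le_of_abs_add_sub_le (E : ℕ → ℝ) (b : ℕ) (hb : 0 < b) (m : ℕ) (K : ℝ)
    (hE : ∀ n, |E (n + b) - E n| ≤ K * m * ((n : ℝ) + 1) ^ (m - 1)) :
    ∃ C : ℝ, 0 ≤ C ∧ ∀ n, |E n| ≤ C * ((n : ℝ) + 1) ^ m := by
  refine ⟨|K| * m + ∑ i ∈ Finset.range b, |E i|, by positivity, fun n => ?_⟩
  set C := |K| * m + ∑ i ∈ Finset.range b, |E i| with hC
  have hsum : 0 ≤ ∑ i ∈ Finset.range b, |E i| := Finset.sum_nonneg fun _ _ => abs_nonneg _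
  have hKm : 0 ≤ |K| * m := by positivity
  induction n using Nat.strong_induction_on with
  | _ n ih =>
    rcases lt_or_ge n b with hn | hn
    · have h1 : |E n| ≤ ∑ i ∈ Finset.range b, |E i| :=
        Finset.single_le_sum (f := fun i => |E i|) (fun _ _ => abs_nonneg _)
          (Finset.mem_range.2 hn)
      have h2 : (1 : ℝ) ≤ ((n : ℝ) + 1) ^ m := one_le_pow₀ (by linarith [n.cast_nonneg (α := ℝ)])
      nlinarith
    · obtain ⟨p, rfl⟩ := Nat.exists_eq_add_of_le' hn
      have hp : (0 : ℝ) ≤ p := p.cast_nonneg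
      have hb' : (1 : ℝ) ≤ b := by exact_mod_cast hb
      have h1 := ih p (by omega)
      have h2 : |E (p + b)| ≤ |E p| + |E (p + b) - E p| := by
        simpa using abs_add_le (E p) (E (p + b) - E p)
      have h3 := (hE p).trans (show K * m * ((p : ℝ) + 1) ^ (m - 1) ≤
        |K| * m * ((p : ℝ) + 1) ^ (m - 1) by gcongr; exact le_abs_self K)
      have hC0 : 0 ≤ C := by positivity
      rcases m with _ | m
      · simp only [Nat.cast_zero, mul_zero, zero_mul, pow_zero, mul_one] at h1 h3 ⊢
        linarith
      · have h4 : ((p : ℝ) + 1) ^ (m + 1) + ((p : ℝ) + 1) ^ m ≤ ((p + b : ℕ) + 1 : ℝ) ^ (m + 1) := by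
          calc _ = ((p : ℝ) + 1) ^ m * (p + 1 + 1) := by ring
            _ ≤ ((p + b : ℕ) + 1 : ℝ) ^ m * ((p + b : ℕ) + 1) := by
                push_cast; gcongr ?_ ^ m * ?_ <;> linarith
            _ = _ := by ring
        have h5 : |K| * (m + 1 : ℕ) * ((p : ℝ) + 1) ^ m ≤ C * ((p : ℝ) + 1) ^ m := by
          gcongr; linarith
        simp only [Nat.add_sub_cancel] at h3
        nlinarith [mul_le_mul_of_nonneg_left h4 hC0]

theorem exists_abs_sub_le_of_add_eq (F G : ℕ → ℝ) (a g m : ℕ) (ha : 0 < a) (hg : 0 < g)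
    (c C : ℝ) (hC : 0 ≤ C)
    (hF : ∀ n, |F n - if g ∣ n then c * (n : ℝ) ^ m else 0| ≤ C * m * ((n : ℝ) + 1) ^ (m - 1))
    (hG : ∀ n, G (n + a) = G n + F (n + a)) :
    ∃ C' : ℝ, 0 ≤ C' ∧ ∀ n, |G n - if g.gcd a ∣ n then
      c * (g.gcd a) / ((m + 1) * a * g) * (n : ℝ) ^ (m + 1) else 0| ≤ C' * ((n : ℝ) + 1) ^ m := by
  set d := g.gcd a with hd
  have hdpos : 0 < d := Nat.gcd_pos_of_pos_left _ hg
  obtain ⟨h, hgh⟩ : d ∣ g := Nat.gcd_dvd_left g a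
  have hh : 0 < h := Nat.pos_of_ne_zero fun h0 => by simp [h0] at hgh; omega
  have hdiv : g / d = h := by rw [hgh]; exact Nat.mul_div_cancel_left _ hdpos
  set b := a * h with hb
  have hdb : d ∣ b := (Nat.gcd_dvd_right g a).mul_right h
  set c' : ℝ := c * d / ((m + 1) * a * g) with hc'
  have hcc : c' * ((m + 1) * b) = c := by
    rw [hc', hb, hgh]; push_cast; field_simp
  have hsum : ∀ N n, G (n + a * N) = G n + ∑ j ∈ Finset.range N, F (n + a * (j + 1)) := by
    intro N n
    induction N with
    | zero => simp
    | succ N ih => rw [Finset.sum_range_succ, ← add_assoc, ← ih, mul_add, mul_one, ← add_assoc, hG]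
  obtain ⟨K, hK, hKn⟩ := exists_abs_add_pow_succ_sub_le b (Nat.cast_nonneg b) m
  -- the error committed when replacing each summand by its main term at `n`
  have hterm : ∀ j, ∃ L : ℝ, ∀ n, |F (n + a * (j + 1)) -
      if g ∣ n + a * (j + 1) then c * (n : ℝ) ^ m else 0| ≤ L * m * ((n : ℝ) + 1) ^ (m - 1) := by
    intro j
    set t := a * (j + 1) with ht
    refine ⟨C * (1 + t) ^ (m - 1) + |c| * (t * (1 + t) ^ (m - 1)), fun n => ?_⟩
    have h1 := hF (n + t)
    have h2 : C * m * (((n + t : ℕ) : ℝ) + 1) ^ (m - 1) ≤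
        C * m * ((1 + t) ^ (m - 1) * ((n : ℝ) + 1) ^ (m - 1)) := by
      rw [← mul_pow]
      gcongr
      push_cast
      nlinarith [n.cast_nonneg (α := ℝ), t.cast_nonneg (α := ℝ),
        mul_nonneg (n.cast_nonneg (α := ℝ)) (t.cast_nonneg (α := ℝ))]
    have h3 : |(if g ∣ n + t then c * ((n + t : ℕ) : ℝ) ^ m else 0) -
        (if g ∣ n + t then c * (n : ℝ) ^ m else 0)| ≤
        |c| * (t * (1 + t) ^ (m - 1) * m * ((n : ℝ) + 1) ^ (m - 1)) := by
      split_ifs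
      · rw [← mul_sub, abs_mul]
        push_cast
        exact mul_le_mul_of_nonneg_left
          (abs_add_pow_sub_pow_le t (Nat.cast_nonneg t) m n) (abs_nonneg c)
      · simp; positivity
    refine (abs_sub_le _ (if g ∣ n + t then c * ((n + t : ℕ) : ℝ) ^ m else 0) _).trans ?_
    linarith
  choose L hL using hterm
  refine exists_abs_le_of_abs_add_sub_le _ b (Nat.mul_pos ha hh) m
    (∑ j ∈ Finset.range h, L j + |c'| * K) fun n => ?_
  have hmain : ∑ j ∈ Finset.range h, (if g ∣ n + a * (j + 1) then c * (n : ℝ) ^ m else 0) =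
      if d ∣ n then c * (n : ℝ) ^ m else 0 := by
    have := card_filter_dvd_add_mul g a n hg
    rw [← hd, hdiv] at this
    rw [← Finset.sum_filter, Finset.sum_const, this]
    split_ifs <;> simp
  have h1 : |∑ j ∈ Finset.range h, F (n + a * (j + 1)) - if d ∣ n then c * (n : ℝ) ^ m else 0| ≤
      (∑ j ∈ Finset.range h, L j) * m * ((n : ℝ) + 1) ^ (m - 1) := by
    rw [← hmain, ← Finset.sum_sub_distrib, Finset.sum_mul, Finset.sum_mul]
    exact (Finset.abs_sum_le_sum_abs _ _).trans (Finset.sum_le_sum fun j _ => hL j n)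
  have h2 : |(if d ∣ n then c * (n : ℝ) ^ m else 0) -
      ((if d ∣ n + b then c' * ((n + b : ℕ) : ℝ) ^ (m + 1) else 0) -
        if d ∣ n then c' * (n : ℝ) ^ (m + 1) else 0)| ≤
      |c'| * (K * m * ((n : ℝ) + 1) ^ (m - 1)) := by
    simp only [Nat.dvd_add_left hdb]
    split_ifs
    · rw [abs_sub_comm]
      calc _ = |c' * (((n : ℝ) + b) ^ (m + 1) - (n : ℝ) ^ (m + 1) - (m + 1) * b * n ^ m)| := by
            congr 1
            push_cast
            linear_combination (n : ℝ) ^ m * hcc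
        _ ≤ _ := by
            rw [abs_mul]
            exact mul_le_mul_of_nonneg_left (hKn n) (abs_nonneg _)
    · simp; positivity
  rw [hsum h n]
  calc _ = |(∑ j ∈ Finset.range h, F (n + a * (j + 1)) - if d ∣ n then c * (n : ℝ) ^ m else 0) +
        ((if d ∣ n then c * (n : ℝ) ^ m else 0) -
      ((if d ∣ n + b then c' * ((n + b : ℕ) : ℝ) ^ (m + 1) else 0) -
        if d ∣ n then c' * (n : ℝ) ^ (m + 1) else 0))| := by
        congr 1; ring
    _ ≤ _ := (abs_add_le _ _).trans (add_le_add h1 h2)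
    _ = _ := by ring

theorem gcdUpTo_succ (a : ℕ → ℕ) (k : ℕ) : gcdUpTo a (k + 1) = (gcdUpTo a k).gcd (a (k + 1)) := by
  unfold gcdUpTo
  rw [← Finset.insert_Icc_right_eq_Icc_add_one (by omega), Finset.gcd_insert]
  exact Nat.gcd_comm _ _

theorem gcdUpTo_succ_pos (a : ℕ → ℕ) (ha : ∀ i, 1 ≤ a i) (k : ℕ) : 0 < gcdUpTo a (k + 1) := by
  rw [gcdUpTo_succ]
  exact Nat.gcd_pos_of_pos_right _ (ha _)

/-- The asymptotic expansion of the denumerant without any assumption on the gcd. -/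
theorem exists_abs_D_succ_sub_le (a : ℕ → ℕ) (ha : ∀ i, 1 ≤ a i) (m : ℕ) :
    ∃ C : ℝ, 0 ≤ C ∧ ∀ n, |(D a (m + 1) n : ℝ) - if gcdUpTo a (m + 1) ∣ n then
      gcdUpTo a (m + 1) / ((Nat.factorial m : ℝ) * ∏ i ∈ Finset.Icc 1 (m + 1), (a i : ℝ)) *
        (n : ℝ) ^ m else 0| ≤ C * m * ((n : ℝ) + 1) ^ (m - 1) := by
  induction m with
  | zero =>
    refine ⟨0, le_rfl, fun n => ?_⟩
    have h1 : gcdUpTo a 1 = a 1 := by simp [gcdUpTo]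
    have h2 : (a 1 : ℝ) ≠ 0 := by have := ha 1; positivity
    simp [D_one a ha, h1, h2]
  | succ m ih =>
    obtain ⟨C, hC, h⟩ := ih
    obtain ⟨C', hC', h'⟩ := exists_abs_sub_le_of_add_eq (fun n => (D a (m + 1) n : ℝ))
      (fun n => (D a (m + 1 + 1) n : ℝ)) (a (m + 1 + 1)) (gcdUpTo a (m + 1)) m (ha _)
      (gcdUpTo_succ_pos a ha m) _ C hC h
      (fun n => by exact_mod_cast D_succ_add a ha (m + 1) n)
    refine ⟨C', hC', fun n => ?_⟩
    have hn := h' n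
    rw [← gcdUpTo_succ] at hn
    have hgpos : (gcdUpTo a (m + 1) : ℝ) ≠ 0 := by
      exact_mod_cast (gcdUpTo_succ_pos a ha m).ne'
    have hcoef : (gcdUpTo a (m + 1) : ℝ) /
          ((Nat.factorial m : ℝ) * ∏ i ∈ Finset.Icc 1 (m + 1), (a i : ℝ)) *
          gcdUpTo a (m + 1 + 1) / ((m + 1) * a (m + 1 + 1) * gcdUpTo a (m + 1)) =
        gcdUpTo a (m + 1 + 1) /
          ((Nat.factorial (m + 1) : ℝ) * ∏ i ∈ Finset.Icc 1 (m + 1 + 1), (a i : ℝ)) := by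
      rw [Finset.prod_Icc_succ_top (b := m + 1) (by omega), Nat.factorial_succ]
      push_cast
      field_simp
    rw [hcoef] at hn
    refine hn.trans ?_
    simp only [Nat.add_sub_cancel]
    gcongr
    push_cast
    nlinarith [m.cast_nonneg (α := ℝ), mul_nonneg hC' (m.cast_nonneg (α := ℝ))]

open Asymptotics in
/-- Asymptotic behaviour of the denumerant. -/
theorem denumerant_asymptotic (a : ℕ → ℕ) (ha : ∀ i, 1 ≤ a i) (k : ℕ) (hk : 2 ≤ k)
    (hgcd : gcdUpTo a k = 1) :
    (fun n : ℕ => (D a k n : ℝ) - (n : ℝ) ^ (k - 1) /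
        ((Nat.factorial (k - 1) : ℝ) * ∏ i ∈ Finset.Icc 1 k, (a i : ℝ)))
      =O[Filter.atTop] fun n : ℕ => (n : ℝ) ^ (k - 2) := by
  obtain ⟨m, rfl⟩ := Nat.exists_eq_add_of_le' hk
  obtain ⟨C, hC, h⟩ := exists_abs_D_succ_sub_le a ha (m + 1)
  refine IsBigO.of_bound (C * (m + 1 : ℕ) * 2 ^ m) ?_
  filter_upwards [Filter.eventually_ge_atTop 1] with n hn
  have hn' : (1 : ℝ) ≤ n := by exact_mod_cast hn
  have h1 := h n
  rw [show m + 1 + 1 = m + 2 from rfl, hgcd, if_pos (one_dvd n)] at h1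
  rw [Real.norm_eq_abs, Real.norm_eq_abs, abs_of_nonneg (by positivity : (0 : ℝ) ≤ (n : ℝ) ^ _)]
  calc _ ≤ C * (m + 1 : ℕ) * ((n : ℝ) + 1) ^ m := by
        refine le_of_eq_of_le ?_ h1
        congr 2
        simp only [Nat.cast_one, show m + 2 - 1 = m + 1 from rfl]
        ring
    _ ≤ C * (m + 1 : ℕ) * (2 * (n : ℝ)) ^ m := by gcongr; linarith
    _ = _ := by rw [mul_pow, Nat.add_sub_cancel]; ring
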